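/- arXiv:1209.4575 — 2 statements merged into one kernel-verified Lean document; each statement's English description precedes it below -/
import Mathlib

section
/- Let T ⊆ B(H,K) be a TRO and X ⊆ T a nondegenerate sub-TRO. If E and E' are two conditional expectations from the linking algebra A_T onto the linking algebra A_X which agree on the corner copy of T, i.e. E([[0, t], [0, 0]]) = E'([[0, t], [0, 0]]) for every t ∈ T, then E = E'. -/
noncomputable section

open ContinuousLinearMap

/-- The closed linear span of a set in a complex normed space. -/
def cspan {V : Type*} [NormedAddCommGroup V] [NormedSpace ℂ V] (S : Set V) : Set V :=
  closure (Submodule.span ℂ S : Set V)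

variable {H K : Type*} [NormedAddCommGroup H] [InnerProductSpace ℂ H] [CompleteSpace H]
  [NormedAddCommGroup K] [InnerProductSpace ℂ K] [CompleteSpace K]

/-- The ternary product `a b* c` of operators in `B(H,K)`. -/
def tp (a b c : H →L[ℂ] K) : H →L[ℂ] K :=
  a ∘L ((ContinuousLinearMap.adjoint b) ∘L c)

/-- A TRO: a norm-closed linear subspace of `B(H,K)` stable under `(a,b,c) ↦ a b* c`. -/
def IsTRO (T : Set (H →L[ℂ] K)) : Prop :=
  IsClosed T ∧ (∃ S : Submodule ℂ (H →L[ℂ] K), T = ↑S) ∧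
    ∀ a ∈ T, ∀ b ∈ T, ∀ c ∈ T, tp a b c ∈ T

/-- A sub-TRO of `T`: a norm-closed linear subspace of `T` stable under the ternary product. -/
def IsSubTRO (T X : Set (H →L[ℂ] K)) : Prop :=
  X ⊆ T ∧ IsClosed X ∧ (∃ S : Submodule ℂ (H →L[ℂ] K), X = ↑S) ∧
    ∀ a ∈ X, ∀ b ∈ X, ∀ c ∈ X, tp a b c ∈ X

/-- The set `{a b* : a ∈ T₁, b ∈ T₂} ⊆ B(K)`. -/
def setMulStar (T₁ T₂ : Set (H →L[ℂ] K)) : Set (K →L[ℂ] K) :=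
  {w | ∃ a ∈ T₁, ∃ b ∈ T₂, w = a ∘L ContinuousLinearMap.adjoint b}

/-- The set `{a* b : a ∈ T₁, b ∈ T₂} ⊆ B(H)`. -/
def setStarMul (T₁ T₂ : Set (H →L[ℂ] K)) : Set (H →L[ℂ] H) :=
  {w | ∃ a ∈ T₁, ∃ b ∈ T₂, w = ContinuousLinearMap.adjoint a ∘L b}

/-- Nondegeneracy of a sub-TRO `X ⊆ T`: `⟨X T* T⟩ = T` and `⟨T T* X⟩ = T`. -/
def Nondegenerate (T X : Set (H →L[ℂ] K)) : Prop :=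
  cspan {w | ∃ x ∈ X, ∃ a ∈ T, ∃ b ∈ T, w = tp x a b} = T ∧
  cspan {w | ∃ a ∈ T, ∃ b ∈ T, ∃ x ∈ X, w = tp a b x} = T

/-- A TRO conditional expectation from `T` onto the sub-TRO `X`: a linear idempotent
surjection `P : T → X` (formalised as a map of the ambient space which is linear on `T`,
maps `T` into `X` and fixes `X`) satisfying the three module identities. -/
def IsTROCondExp (T X : Set (H →L[ℂ] K)) (P : (H →L[ℂ] K) → (H →L[ℂ] K)) : Prop :=
  (∀ s ∈ T, ∀ t ∈ T, P (s + t) = P s + P t) ∧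
  (∀ (z : ℂ), ∀ t ∈ T, P (z • t) = z • P t) ∧
  (∀ t ∈ T, P t ∈ X) ∧ (∀ x ∈ X, P x = x) ∧
  (∀ a ∈ T, ∀ x ∈ X, ∀ y ∈ X, P (tp a x y) = tp (P a) x y) ∧
  (∀ a ∈ T, ∀ x ∈ X, ∀ y ∈ X, P (tp x a y) = tp x (P a) y) ∧
  (∀ a ∈ T, ∀ x ∈ X, ∀ y ∈ X, P (tp x y a) = tp x y (P a))

/-- `P` is contractive on the set `S`. -/
def ContractiveOn {V W : Type*} [Norm V] [Norm W] (S : Set V) (P : V → W) : Prop :=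
  ∀ v ∈ S, ‖P v‖ ≤ ‖v‖

/-- The block operator `[[c, t], [s, d]]` on the Hilbert space direct sum `K ⊕ H`. -/
def blockOp (c : K →L[ℂ] K) (t : H →L[ℂ] K) (s : K →L[ℂ] H) (d : H →L[ℂ] H) :
    WithLp 2 (K × H) →L[ℂ] WithLp 2 (K × H) :=
  ((WithLp.prodContinuousLinearEquiv 2 ℂ K H).symm :
      (K × H) →L[ℂ] WithLp 2 (K × H)) ∘L
    ((c ∘L ContinuousLinearMap.fst ℂ K H + t ∘L ContinuousLinearMap.snd ℂ K H).prod
      (s ∘L ContinuousLinearMap.fst ℂ K H + d ∘L ContinuousLinearMap.snd ℂ K H)) ∘L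
    ((WithLp.prodContinuousLinearEquiv 2 ℂ K H : WithLp 2 (K × H) →L[ℂ] K × H))

/-- The linking algebra `A_T ⊆ B(K ⊕ H)` of a TRO `T`, consisting of the block operators
`[[c, t], [s*, d]]` with `c ∈ ⟨T T*⟩`, `t, s ∈ T`, `d ∈ ⟨T* T⟩`. -/
def linkingAlgebra (T : Set (H →L[ℂ] K)) :
    Set (WithLp 2 (K × H) →L[ℂ] WithLp 2 (K × H)) :=
  {w | ∃ c ∈ cspan (setMulStar T T), ∃ t ∈ T, ∃ s ∈ T, ∃ d ∈ cspan (setStarMul T T),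
    w = blockOp c t (ContinuousLinearMap.adjoint s) d}

/-- The corner copy `[[0, t], [0, 0]]` of `t ∈ T` inside the linking algebra. -/
def cornerOp (t : H →L[ℂ] K) : WithLp 2 (K × H) →L[ℂ] WithLp 2 (K × H) :=
  blockOp 0 t 0 0

/-- A conditional expectation from a C*-algebra of operators `A` onto a subalgebra `B`
(formalised as a map of the ambient operator algebra which is linear and contractive
on `A`, maps `A` into `B`, fixes `B` and is a `B`-bimodule map on `A`). -/
def IsCondExp {L : Type*} [NormedAddCommGroup L] [InnerProductSpace ℂ L] [CompleteSpace L]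
    (A B : Set (L →L[ℂ] L)) (E : (L →L[ℂ] L) → (L →L[ℂ] L)) : Prop :=
  (∀ a ∈ A, ∀ b ∈ A, E (a + b) = E a + E b) ∧
  (∀ (z : ℂ), ∀ a ∈ A, E (z • a) = z • E a) ∧
  (∀ a ∈ A, ‖E a‖ ≤ ‖a‖) ∧
  (∀ a ∈ A, E a ∈ B) ∧ (∀ b ∈ B, E b = b) ∧
  (∀ a ∈ A, ∀ b ∈ B, E (a ∘L b) = E a ∘L b ∧ E (b ∘L a) = b ∘L E a)

theorem cspan_subset_of_isClosed {V : Type*} [NormedAddCommGroup V] [NormedSpace ℂ V]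
    {S : Set V} (M : Submodule ℂ V) (hM : IsClosed (M : Set V)) (h : S ⊆ M) :
    cspan S ⊆ M :=
  closure_minimal (Submodule.span_le.2 h) hM

theorem zero_mem_cspan {V : Type*} [NormedAddCommGroup V] [NormedSpace ℂ V] (S : Set V) :
    (0 : V) ∈ cspan S :=
  subset_closure (Submodule.zero_mem _)

theorem subset_cspan {V : Type*} [NormedAddCommGroup V] [NormedSpace ℂ V] (S : Set V) :
    S ⊆ cspan S :=
  Submodule.subset_span.trans subset_closure

theorem sub_mem_cspan {V : Type*} [NormedAddCommGroup V] [NormedSpace ℂ V] {S : Set V}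
    {a b : V} (ha : a ∈ cspan S) (hb : b ∈ cspan S) : a - b ∈ cspan S :=
  (Submodule.span ℂ S).topologicalClosure.sub_mem ha hb

/-- A bounded linear map sending `S` into a closed subspace sends `cspan S` into it. -/
theorem map_mem_of_mem_cspan {V W : Type*} [NormedAddCommGroup V] [NormedSpace ℂ V]
    [NormedAddCommGroup W] [NormedSpace ℂ W] {S : Set V} (F : V →L[ℂ] W) (M : Submodule ℂ W)
    (hM : IsClosed (M : Set W)) (h : ∀ v ∈ S, F v ∈ M) {v : V} (hv : v ∈ cspan S) : F v ∈ M :=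
  cspan_subset_of_isClosed (M.comap (F : V →ₗ[ℂ] W)) (hM.preimage F.continuous) h hv

theorem comp_mem_of_mem_cspan {E F G : Type*} [NormedAddCommGroup E] [NormedSpace ℂ E]
    [NormedAddCommGroup F] [NormedSpace ℂ F] [NormedAddCommGroup G] [NormedSpace ℂ G]
    {S : Set (F →L[ℂ] G)} (x : E →L[ℂ] F) (M : Submodule ℂ (E →L[ℂ] G))
    (hM : IsClosed (M : Set (E →L[ℂ] G))) (h : ∀ c ∈ S, c ∘L x ∈ M) {c : F →L[ℂ] G}
    (hc : c ∈ cspan S) : c ∘L x ∈ M :=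
  map_mem_of_mem_cspan ((compL ℂ E F G).flip x) M hM h hc

theorem comp_mem_of_mem_cspan' {E F G : Type*} [NormedAddCommGroup E] [NormedSpace ℂ E]
    [NormedAddCommGroup F] [NormedSpace ℂ F] [NormedAddCommGroup G] [NormedSpace ℂ G]
    {S : Set (E →L[ℂ] F)} (x : F →L[ℂ] G) (M : Submodule ℂ (E →L[ℂ] G))
    (hM : IsClosed (M : Set (E →L[ℂ] G))) (h : ∀ d ∈ S, x ∘L d ∈ M) {d : E →L[ℂ] F}
    (hd : d ∈ cspan S) : x ∘L d ∈ M :=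
  map_mem_of_mem_cspan (compL ℂ E F G x) M hM h hd

theorem eq_zero_of_adjoint_comp_self {E F : Type*} [NormedAddCommGroup E]
    [InnerProductSpace ℂ E] [CompleteSpace E] [NormedAddCommGroup F] [InnerProductSpace ℂ F]
    [CompleteSpace F] {a : E →L[ℂ] F} (h : adjoint a ∘L a = 0) : a = 0 := by
  have := ContinuousLinearMap.norm_adjoint_comp_self a
  rw [h, norm_zero] at this
  exact norm_eq_zero.1 (mul_self_eq_zero.1 this.symm)

theorem eq_zero_of_comp_adjoint_self {E F : Type*} [NormedAddCommGroup E]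
    [InnerProductSpace ℂ E] [CompleteSpace E] [NormedAddCommGroup F] [InnerProductSpace ℂ F]
    [CompleteSpace F] {a : E →L[ℂ] F} (h : a ∘L adjoint a = 0) : a = 0 := by
  have : adjoint a = 0 := eq_zero_of_adjoint_comp_self (by rwa [adjoint_adjoint])
  simpa using congrArg adjoint this

/-- If the linear span of `S` is annihilated on the left by `c*`, so is its closure; in
particular `c ∈ cspan S` then vanishes. -/
theorem eq_zero_of_adjoint_comp_eq_zero {E F : Type*} [NormedAddCommGroup E]
    [InnerProductSpace ℂ E] [CompleteSpace E] [NormedAddCommGroup F] [InnerProductSpace ℂ F]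
    [CompleteSpace F] {S : Set (E →L[ℂ] F)} {c : E →L[ℂ] F} (hc : c ∈ cspan S)
    (h : ∀ a ∈ S, adjoint c ∘L a = 0) : c = 0 :=
  eq_zero_of_adjoint_comp_self ((Submodule.mem_bot ℂ).1
    (comp_mem_of_mem_cspan' (adjoint c) ⊥ (by simp) (fun a ha ↦ by simp [h a ha]) hc))

theorem eq_zero_of_comp_adjoint_eq_zero {E F : Type*} [NormedAddCommGroup E]
    [InnerProductSpace ℂ E] [CompleteSpace E] [NormedAddCommGroup F] [InnerProductSpace ℂ F]
    [CompleteSpace F] {S : Set (E →L[ℂ] F)} {c : E →L[ℂ] F} (hc : c ∈ cspan S)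
    (h : ∀ a ∈ S, a ∘L adjoint c = 0) : c = 0 :=
  eq_zero_of_comp_adjoint_self ((Submodule.mem_bot ℂ).1
    (comp_mem_of_mem_cspan (adjoint c) ⊥ (by simp) (fun a ha ↦ by simp [h a ha]) hc))

theorem eq_zero_of_mem_cspan_setMulStar {X : Set (H →L[ℂ] K)} {c : K →L[ℂ] K}
    (hc : c ∈ cspan (setMulStar X X)) (h : ∀ x ∈ X, c ∘L x = 0) : c = 0 := by
  refine eq_zero_of_comp_adjoint_eq_zero hc ?_
  rintro _ ⟨a, -, b, hb, rfl⟩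
  rw [comp_assoc, ← adjoint_comp, h b hb, map_zero, comp_zero]

theorem eq_zero_of_mem_cspan_setMulStar' {X : Set (H →L[ℂ] K)} {c : K →L[ℂ] K}
    (hc : c ∈ cspan (setMulStar X X)) (h : ∀ x ∈ X, adjoint x ∘L c = 0) : c = 0 := by
  refine eq_zero_of_adjoint_comp_eq_zero hc ?_
  rintro _ ⟨a, ha, b, -, rfl⟩
  have := congrArg adjoint (h a ha)
  rw [adjoint_comp, adjoint_adjoint, map_zero] at this
  rw [← comp_assoc, this, zero_comp]

theorem eq_zero_of_mem_cspan_setStarMul {X : Set (H →L[ℂ] K)} {d : H →L[ℂ] H}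
    (hd : d ∈ cspan (setStarMul X X)) (h : ∀ x ∈ X, d ∘L adjoint x = 0) : d = 0 := by
  refine eq_zero_of_comp_adjoint_eq_zero hd ?_
  rintro _ ⟨a, -, b, hb, rfl⟩
  have := congrArg adjoint (h b hb)
  rw [adjoint_comp, adjoint_adjoint, map_zero] at this
  rw [comp_assoc, this, comp_zero]

theorem eq_zero_of_mem_cspan_setStarMul' {X : Set (H →L[ℂ] K)} {d : H →L[ℂ] H}
    (hd : d ∈ cspan (setStarMul X X)) (h : ∀ x ∈ X, x ∘L d = 0) : d = 0 := by
  refine eq_zero_of_adjoint_comp_eq_zero hd ?_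
  rintro _ ⟨a, ha, b, -, rfl⟩
  rw [← comp_assoc, ← adjoint_comp, h a ha, map_zero, zero_comp]

theorem IsTRO.comp_mem {T : Set (H →L[ℂ] K)} (hT : IsTRO T) {c : K →L[ℂ] K}
    (hc : c ∈ cspan (setMulStar T T)) {t : H →L[ℂ] K} (ht : t ∈ T) : c ∘L t ∈ T := by
  obtain ⟨hcl, ⟨M, rfl⟩, htp⟩ := hT
  refine comp_mem_of_mem_cspan t M hcl ?_ hc
  rintro _ ⟨a, ha, b, hb, rfl⟩
  exact htp a ha b hb t ht

theorem IsTRO.comp_mem' {T : Set (H →L[ℂ] K)} (hT : IsTRO T) {d : H →L[ℂ] H}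
    (hd : d ∈ cspan (setStarMul T T)) {t : H →L[ℂ] K} (ht : t ∈ T) : t ∘L d ∈ T := by
  obtain ⟨hcl, ⟨M, rfl⟩, htp⟩ := hT
  refine comp_mem_of_mem_cspan' t M hcl ?_ hd
  rintro _ ⟨a, ha, b, hb, rfl⟩
  exact htp t ht a ha b hb

theorem blockOp_comp_blockOp (c c' : K →L[ℂ] K) (t t' : H →L[ℂ] K) (s s' : K →L[ℂ] H)
    (d d' : H →L[ℂ] H) :
    blockOp c t s d ∘L blockOp c' t' s' d' =
      blockOp (c ∘L c' + t ∘L s') (c ∘L t' + t ∘L d') (s ∘L c' + d ∘L s')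
        (s ∘L t' + d ∘L d') := by
  ext v
  refine WithLp.ofLp_injective 2 (Prod.ext ?_ ?_) <;> simp [blockOp] <;> abel

theorem blockOp_add (c c' : K →L[ℂ] K) (t t' : H →L[ℂ] K) (s s' : K →L[ℂ] H)
    (d d' : H →L[ℂ] H) :
    blockOp (c + c') (t + t') (s + s') (d + d') = blockOp c t s d + blockOp c' t' s' d' := by
  ext v
  refine WithLp.ofLp_injective 2 (Prod.ext ?_ ?_) <;> simp [blockOp] <;> abel

theorem blockOp_sub (c c' : K →L[ℂ] K) (t t' : H →L[ℂ] K) (s s' : K →L[ℂ] H)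
    (d d' : H →L[ℂ] H) :
    blockOp (c - c') (t - t') (s - s') (d - d') = blockOp c t s d - blockOp c' t' s' d' := by
  ext v
  refine WithLp.ofLp_injective 2 (Prod.ext ?_ ?_) <;> simp [blockOp] <;> abel

theorem blockOp_zero : blockOp (0 : K →L[ℂ] K) (0 : H →L[ℂ] K) 0 0 = 0 := by
  ext v
  simp [blockOp]

theorem blockOp_eq_zero {c : K →L[ℂ] K} {t : H →L[ℂ] K} {s : K →L[ℂ] H} {d : H →L[ℂ] H} :
    blockOp c t s d = 0 ↔ c = 0 ∧ t = 0 ∧ s = 0 ∧ d = 0 := by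
  refine ⟨fun h ↦ ?_, ?_⟩
  · have hK (k : K) := congrArg (fun f ↦ f (WithLp.toLp 2 (k, (0 : H)))) h
    have hH (x : H) := congrArg (fun f ↦ f (WithLp.toLp 2 ((0 : K), x))) h
    have hK' (k : K) : c k = 0 ∧ s k = 0 := by
      simpa [blockOp] using congrArg WithLp.ofLp (hK k)
    have hH' (x : H) : t x = 0 ∧ d x = 0 := by
      simpa [blockOp] using congrArg WithLp.ofLp (hH x)
    exact ⟨ext fun k ↦ (hK' k).1, ext fun x ↦ (hH' x).1, ext fun k ↦ (hK' k).2,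
      ext fun x ↦ (hH' x).2⟩
  · rintro ⟨rfl, rfl, rfl, rfl⟩
    exact blockOp_zero

theorem sub_mem_linkingAlgebra {X : Set (H →L[ℂ] K)}
    (hX : ∃ S : Submodule ℂ (H →L[ℂ] K), X = ↑S) {v w : WithLp 2 (K × H) →L[ℂ] WithLp 2 (K × H)}
    (hv : v ∈ linkingAlgebra X) (hw : w ∈ linkingAlgebra X) : v - w ∈ linkingAlgebra X := by
  obtain ⟨M, rfl⟩ := hX
  obtain ⟨c, hc, t, ht, s, hs, d, hd, rfl⟩ := hv
  obtain ⟨c', hc', t', ht', s', hs', d', hd', rfl⟩ := hw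
  exact ⟨c - c', sub_mem_cspan hc hc', t - t', M.sub_mem ht ht', s - s', M.sub_mem hs hs',
    d - d', sub_mem_cspan hd hd', by rw [map_sub, blockOp_sub]⟩

/-- An element of the linking algebra of `X` whose right products with the off-diagonal
corners all vanish is zero. -/
theorem eq_zero_of_mem_linkingAlgebra_of_comp {X : Set (H →L[ℂ] K)}
    {v : WithLp 2 (K × H) →L[ℂ] WithLp 2 (K × H)} (hv : v ∈ linkingAlgebra X)
    (h₁ : ∀ x ∈ X, v ∘L blockOp 0 x 0 0 = 0)
    (h₂ : ∀ x ∈ X, v ∘L blockOp 0 0 (adjoint x) 0 = 0) : v = 0 := by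
  obtain ⟨c, hc, t, ht, s, hs, d, hd, rfl⟩ := hv
  simp only [blockOp_comp_blockOp, blockOp_eq_zero, comp_zero, add_zero, zero_add,
    true_and, and_true] at h₁ h₂
  have hs0 : s = 0 := eq_zero_of_adjoint_comp_self (h₁ s hs).2
  exact blockOp_eq_zero.2 ⟨eq_zero_of_mem_cspan_setMulStar hc fun x hx ↦ (h₁ x hx).1,
    eq_zero_of_comp_adjoint_self (h₂ t ht).1, by rw [hs0, map_zero],
    eq_zero_of_mem_cspan_setStarMul hd fun x hx ↦ (h₂ x hx).2⟩

/-- An element of the linking algebra of `X` whose left products with the off-diagonal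
corners all vanish is zero. -/
theorem eq_zero_of_mem_linkingAlgebra_of_comp' {X : Set (H →L[ℂ] K)}
    {v : WithLp 2 (K × H) →L[ℂ] WithLp 2 (K × H)} (hv : v ∈ linkingAlgebra X)
    (h₁ : ∀ x ∈ X, blockOp 0 x 0 0 ∘L v = 0)
    (h₂ : ∀ x ∈ X, blockOp 0 0 (adjoint x) 0 ∘L v = 0) : v = 0 := by
  obtain ⟨c, hc, t, ht, s, hs, d, hd, rfl⟩ := hv
  simp only [blockOp_comp_blockOp, blockOp_eq_zero, zero_comp, add_zero, zero_add,
    true_and, and_true] at h₁ h₂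
  have hs0 : s = 0 := eq_zero_of_comp_adjoint_self (h₁ s hs).1
  exact blockOp_eq_zero.2 ⟨eq_zero_of_mem_cspan_setMulStar' hc fun x hx ↦ (h₂ x hx).1,
    eq_zero_of_adjoint_comp_self (h₂ t ht).2, by rw [hs0, map_zero],
    eq_zero_of_mem_cspan_setStarMul' hd fun x hx ↦ (h₁ x hx).2⟩

theorem IsCondExp.map_zero {L : Type*} [NormedAddCommGroup L] [InnerProductSpace ℂ L]
    [CompleteSpace L] {A B : Set (L →L[ℂ] L)} {E : (L →L[ℂ] L) → (L →L[ℂ] L)}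
    (hE : IsCondExp A B E) (h : 0 ∈ A) : E 0 = 0 := by
  simpa using hE.2.1 0 0 h

/-- Two conditional expectations from `A_T` onto `A_X` which agree on the
corner copy of `T` coincide on `A_T`. -/
theorem conditional_expectation_unique
    (T X : Set (H →L[ℂ] K))
    (E E' : (WithLp 2 (K × H) →L[ℂ] WithLp 2 (K × H)) →
      (WithLp 2 (K × H) →L[ℂ] WithLp 2 (K × H)))
    (hT : IsTRO T) (hX : IsSubTRO T X) (hXnd : Nondegenerate T X)
    (hE : IsCondExp (linkingAlgebra T) (linkingAlgebra X) E)
    (hE' : IsCondExp (linkingAlgebra T) (linkingAlgebra X) E')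
    (hcorner : ∀ t ∈ T, E (cornerOp t) = E' (cornerOp t)) :
    ∀ w ∈ linkingAlgebra T, E w = E' w := by
  have hXT := hX.1
  have hXsub := hX.2.2.1
  have hX0 : (0 : H →L[ℂ] K) ∈ X := by
    obtain ⟨M, rfl⟩ := hXsub
    exact M.zero_mem
  have hT0 : (0 : H →L[ℂ] K) ∈ T := hXT hX0
  have hcorner_mem {Y : Set (H →L[ℂ] K)} (hY : 0 ∈ Y) {y : H →L[ℂ] K} (hy : y ∈ Y) :
      blockOp 0 y 0 0 ∈ linkingAlgebra Y :=
    ⟨0, zero_mem_cspan _, y, hy, 0, hY, 0, zero_mem_cspan _, by rw [map_zero]⟩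
  have hlower_mem {Y : Set (H →L[ℂ] K)} (hY : 0 ∈ Y) {y : H →L[ℂ] K} (hy : y ∈ Y) :
      blockOp 0 0 (adjoint y) 0 ∈ linkingAlgebra Y :=
    ⟨0, zero_mem_cspan _, 0, hY, y, hy, 0, zero_mem_cspan _, rfl⟩
  have hleft_mem {c : K →L[ℂ] K} (hc : c ∈ cspan (setMulStar T T)) :
      blockOp c (0 : H →L[ℂ] K) 0 0 ∈ linkingAlgebra T :=
    ⟨c, hc, 0, hT0, 0, hT0, 0, zero_mem_cspan _, by rw [map_zero]⟩
  have hright_mem {d : H →L[ℂ] H} (hd : d ∈ cspan (setStarMul T T)) :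
      blockOp (0 : K →L[ℂ] K) 0 0 d ∈ linkingAlgebra T :=
    ⟨0, zero_mem_cspan _, 0, hT0, 0, hT0, d, hd, by rw [map_zero]⟩
  have hzero : E 0 = E' 0 := by
    have h0 : (0 : WithLp 2 (K × H) →L[ℂ] WithLp 2 (K × H)) ∈ linkingAlgebra T := by
      simpa only [blockOp_zero] using hcorner_mem hT0 hT0
    rw [hE.map_zero h0, hE'.map_zero h0]
  obtain ⟨hadd, -, -, hmem, -, hmod⟩ := hE
  obtain ⟨hadd', -, -, hmem', -, hmod'⟩ := hE'
  have hsub {w} (hw : w ∈ linkingAlgebra T) : E w - E' w ∈ linkingAlgebra X :=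
    sub_mem_linkingAlgebra hXsub (hmem w hw) (hmem' w hw)
  have hcompr {w b} (hw : w ∈ linkingAlgebra T) (hb : b ∈ linkingAlgebra X)
      (h : E (w ∘L b) = E' (w ∘L b)) : (E w - E' w) ∘L b = 0 := by
    rw [sub_comp, ← (hmod w hw b hb).1, ← (hmod' w hw b hb).1, h, sub_self]
  have hcompl {w b} (hw : w ∈ linkingAlgebra T) (hb : b ∈ linkingAlgebra X)
      (h : E (b ∘L w) = E' (b ∘L w)) : b ∘L (E w - E' w) = 0 := by
    rw [comp_sub, ← (hmod w hw b hb).2, ← (hmod' w hw b hb).2, h, sub_self]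
  have hleft {c : K →L[ℂ] K} (hc : c ∈ cspan (setMulStar T T)) :
      E (blockOp c 0 0 0) = E' (blockOp c 0 0 0) := by
    refine sub_eq_zero.1 (eq_zero_of_mem_linkingAlgebra_of_comp (hsub (hleft_mem hc))
      (fun x hx ↦ hcompr (hleft_mem hc) (hcorner_mem hX0 hx) ?_)
      (fun x hx ↦ hcompr (hleft_mem hc) (hlower_mem hX0 hx) ?_))
    · simpa [blockOp_comp_blockOp, cornerOp] using hcorner _ (hT.comp_mem hc (hXT hx))
    · simpa [blockOp_comp_blockOp, blockOp_zero] using hzero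
  have hright {d : H →L[ℂ] H} (hd : d ∈ cspan (setStarMul T T)) :
      E (blockOp 0 0 0 d) = E' (blockOp 0 0 0 d) := by
    refine sub_eq_zero.1 (eq_zero_of_mem_linkingAlgebra_of_comp' (hsub (hright_mem hd))
      (fun x hx ↦ hcompl (hright_mem hd) (hcorner_mem hX0 hx) ?_)
      (fun x hx ↦ hcompl (hright_mem hd) (hlower_mem hX0 hx) ?_))
    · simpa [blockOp_comp_blockOp, cornerOp] using hcorner _ (hT.comp_mem' hd (hXT hx))
    · simpa [blockOp_comp_blockOp, blockOp_zero] using hzero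
  have hlower {s : H →L[ℂ] K} (hs : s ∈ T) :
      E (blockOp 0 0 (adjoint s) 0) = E' (blockOp 0 0 (adjoint s) 0) := by
    refine sub_eq_zero.1 (eq_zero_of_mem_linkingAlgebra_of_comp (hsub (hlower_mem hT0 hs))
      (fun x hx ↦ hcompr (hlower_mem hT0 hs) (hcorner_mem hX0 hx) ?_)
      (fun x hx ↦ hcompr (hlower_mem hT0 hs) (hlower_mem hX0 hx) ?_))
    · simpa [blockOp_comp_blockOp] using
        hright (subset_cspan _ ⟨s, hs, x, hXT hx, rfl⟩)
    · simpa [blockOp_comp_blockOp, blockOp_zero] using hzero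
  rintro _ ⟨c, hc, t, ht, s, hs, d, hd, rfl⟩
  have htop : blockOp c t 0 0 ∈ linkingAlgebra T :=
    ⟨c, hc, t, ht, 0, hT0, 0, zero_mem_cspan _, by rw [map_zero]⟩
  have hbot : blockOp 0 0 (adjoint s) d ∈ linkingAlgebra T :=
    ⟨0, zero_mem_cspan _, 0, hT0, s, hs, d, hd, rfl⟩
  have htop_eq : blockOp c t 0 0 = blockOp c 0 0 0 + blockOp 0 t 0 0 := by
    simp [← blockOp_add]
  have hbot_eq : blockOp (0 : K →L[ℂ] K) 0 (adjoint s) d =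
      blockOp 0 0 (adjoint s) 0 + blockOp 0 0 0 d := by
    simp [← blockOp_add]
  have hsplit : blockOp c t (adjoint s) d = blockOp c t 0 0 + blockOp 0 0 (adjoint s) d := by
    simp [← blockOp_add]
  rw [hsplit, hadd _ htop _ hbot, hadd' _ htop _ hbot, htop_eq, hbot_eq,
    hadd _ (hleft_mem hc) _ (hcorner_mem hT0 ht), hadd' _ (hleft_mem hc) _ (hcorner_mem hT0 ht),
    hadd _ (hlower_mem hT0 hs) _ (hright_mem hd), hadd' _ (hlower_mem hT0 hs) _ (hright_mem hd),
    hleft hc, hright hd, hlower hs]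
  exact congrArg₂ _ (congrArg₂ _ rfl (hcorner t ht)) rfl
end
end

section
/- Let T ⊆ B(H,K) be a TRO, X ⊆ T a nondegenerate sub-TRO, and P : T → X a contractive TRO conditional expectation onto X. Then P is completely contractive: for every n ∈ ℕ and every n×n matrix (t_{ij}) with entries in T, the block operator (P(t_{ij}))_{i,j} from the ℓ²-direct sum H^n to the ℓ²-direct sum K^n satisfies ‖(P(t_{ij}))‖ ≤ ‖(t_{ij})‖. -/
noncomputable section

open ContinuousLinearMap

variable {H K : Type*} [NormedAddCommGroup H] [InnerProductSpace ℂ H] [CompleteSpace H]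
  [NormedAddCommGroup K] [InnerProductSpace ℂ K] [CompleteSpace K]

/-- The block operator `(t_{ij}) : H^n → K^n` (ℓ²-direct sums) associated with an `n × n`
matrix of operators, acting by `(ξ_j)_j ↦ (∑_j t_{ij} ξ_j)_i`. -/
def matOp {n : ℕ} (t : Fin n → Fin n → (H →L[ℂ] K)) :
    PiLp 2 (fun _ : Fin n => H) →L[ℂ] PiLp 2 (fun _ : Fin n => K) :=
  ((PiLp.continuousLinearEquiv 2 ℂ (fun _ : Fin n => K)).symm :
      (∀ _ : Fin n, K) →L[ℂ] PiLp 2 (fun _ : Fin n => K)) ∘L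
    (ContinuousLinearMap.pi
      (fun i => ∑ j, (t i j) ∘L ContinuousLinearMap.proj j)) ∘L
    ((PiLp.continuousLinearEquiv 2 ℂ (fun _ : Fin n => H)) :
      PiLp 2 (fun _ : Fin n => H) →L[ℂ] (∀ _ : Fin n, H))

/-- Exponential growth rates compare: `b ^ (2 ^ m)` is dominated by `C * c ^ (2 ^ m - 1)` for all
`m` only if `b ≤ c`. -/
lemma le_of_forall_pow_two_pow_le {b c C : ℝ} (hc : 0 ≤ c)
    (h : ∀ m : ℕ, b ^ 2 ^ m ≤ C * c ^ (2 ^ m - 1)) : b ≤ c := by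
  by_contra! hlt
  have hb : 0 < b := hc.trans_lt hlt
  rcases hc.eq_or_lt with rfl | hc
  · have := h 1
    norm_num at this
    exact absurd this (by positivity)
  · have hratio : 1 < b / c := (one_lt_div hc).2 hlt
    obtain ⟨m, hm⟩ := pow_unbounded_of_one_lt (C / c) hratio
    have hle : (b / c) ^ m ≤ (b / c) ^ 2 ^ m :=
      pow_le_pow_right₀ hratio.le Nat.lt_two_pow_self.le
    have hsplit : c ^ 2 ^ m = c ^ (2 ^ m - 1) * c := by
      rw [← pow_succ, Nat.sub_add_cancel Nat.one_le_two_pow]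
    have hfinal : C / c < b ^ 2 ^ m / c ^ 2 ^ m := by
      rw [← div_pow]
      exact hm.trans_le hle
    rw [hsplit, div_lt_div_iff₀ hc (by positivity)] at hfinal
    have := mul_le_mul_of_nonneg_right (h m) hc.le
    nlinarith

/-- If `‖A d‖ ≤ C ‖d‖` for all `d` in a set `S` of operators into the domain of `A` which is stable
under `A* A`, and `A* A` factors through finitely many members of `S`, then `‖A‖ ≤ C`. -/
lemma opNorm_le_of_stable_set {ι E F G : Type*} [Fintype ι]
    [NormedAddCommGroup E] [InnerProductSpace ℂ E] [CompleteSpace E]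
    [NormedAddCommGroup F] [InnerProductSpace ℂ F] [CompleteSpace F]
    [NormedAddCommGroup G] [InnerProductSpace ℂ G] [CompleteSpace G]
    (A : E →L[ℂ] F) {C : ℝ} (hC : 0 ≤ C) (S : Set (G →L[ℂ] E))
    (hS : ∀ d ∈ S, (adjoint A ∘L A) ∘L d ∈ S) (hbound : ∀ d ∈ S, ‖A ∘L d‖ ≤ C * ‖d‖)
    (d : ι → G →L[ℂ] E) (hd : ∀ j, d j ∈ S) (e : ι → E →L[ℂ] G)
    (hA : adjoint A ∘L A = ∑ j, d j ∘L e j) : ‖A‖ ≤ C := by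
  set B : E →L[ℂ] E := adjoint A ∘L A with hB
  have hself : adjoint B = B := by rw [hB, adjoint_comp, adjoint_adjoint]
  have hstep : ∀ d ∈ S, ‖B ∘L d‖ ≤ C ^ 2 * ‖d‖ := by
    intro d hd
    have hsq : ‖B ∘L d‖ * ‖B ∘L d‖ ≤ ‖A ∘L d‖ * ‖A ∘L (B ∘L d)‖ := by
      rw [← norm_adjoint_comp_self (B ∘L d)]
      have : adjoint (B ∘L d) ∘L (B ∘L d) = adjoint (A ∘L d) ∘L (A ∘L (B ∘L d)) := by
        simp only [adjoint_comp, hself]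
        simp only [hB, comp_assoc]
      rw [this]
      refine (opNorm_comp_le _ _).trans_eq ?_
      rw [LinearIsometryEquiv.norm_map]
    have h₁ := hbound d hd
    have h₂ := hbound _ (hS d hd)
    rcases (norm_nonneg (B ∘L d)).eq_or_lt with h | h
    · rw [← h]; positivity
    · refine le_of_mul_le_mul_right ?_ h
      calc ‖B ∘L d‖ * ‖B ∘L d‖ ≤ ‖A ∘L d‖ * ‖A ∘L (B ∘L d)‖ := hsq
        _ ≤ (C * ‖d‖) * (C * ‖B ∘L d‖) := by gcongr
        _ = C ^ 2 * ‖d‖ * ‖B ∘L d‖ := by ring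
  have hpow : ∀ d ∈ S, ∀ k : ℕ, (B ^ k) ∘L d ∈ S ∧ ‖(B ^ k) ∘L d‖ ≤ (C ^ 2) ^ k * ‖d‖ := by
    intro d hd k
    induction k with
    | zero => simpa [one_def] using hd
    | succ k ih =>
      have hrw : (B ^ (k + 1)) ∘L d = B ∘L ((B ^ k) ∘L d) := by
        rw [pow_succ', mul_def, comp_assoc]
      rw [hrw]
      refine ⟨hS _ ih.1, (hstep _ ih.1).trans ?_⟩
      calc C ^ 2 * ‖(B ^ k) ∘L d‖ ≤ C ^ 2 * ((C ^ 2) ^ k * ‖d‖) := by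
            gcongr
            exact ih.2
        _ = (C ^ 2) ^ (k + 1) * ‖d‖ := by ring
  have hBC : ‖B‖ ≤ C ^ 2 := by
    refine le_of_forall_pow_two_pow_le (C := ∑ j, ‖d j‖ * ‖e j‖) (by positivity) fun m ↦ ?_
    have hsa : IsSelfAdjoint B := hself
    rw [← hsa.norm_pow_two_pow, ← Nat.sub_add_cancel (Nat.one_le_two_pow (n := m)), pow_succ,
      Nat.add_sub_cancel]
    nth_rewrite 2 [hA]
    rw [Finset.mul_sum, Finset.sum_mul]
    refine norm_sum_le_of_le _ fun j _ ↦ ?_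
    calc ‖B ^ (2 ^ m - 1) * (d j ∘L e j)‖ = ‖((B ^ (2 ^ m - 1)) ∘L d j) ∘L e j‖ := by
          rw [mul_def, comp_assoc]
      _ ≤ ‖(B ^ (2 ^ m - 1)) ∘L d j‖ * ‖e j‖ := opNorm_comp_le _ _
      _ ≤ (C ^ 2) ^ (2 ^ m - 1) * ‖d j‖ * ‖e j‖ := by
          gcongr
          exact (hpow _ (hd j) _).2
      _ = ‖d j‖ * ‖e j‖ * (C ^ 2) ^ (2 ^ m - 1) := by ring
  rw [hB, norm_adjoint_comp_self, ← sq] at hBC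
  exact le_of_sq_le_sq hBC hC

/-- The column operator `ξ ↦ (y_i ξ)_i` into an ℓ²-direct sum. -/
def colOp {n : ℕ} (y : Fin n → H →L[ℂ] K) : H →L[ℂ] PiLp 2 (fun _ : Fin n => K) :=
  ((PiLp.continuousLinearEquiv 2 ℂ (fun _ : Fin n => K)).symm :
      (∀ _ : Fin n, K) →L[ℂ] PiLp 2 (fun _ : Fin n => K)) ∘L ContinuousLinearMap.pi y

lemma colOp_apply {E F : Type*} [NormedAddCommGroup E] [InnerProductSpace ℂ E]
    [NormedAddCommGroup F] [InnerProductSpace ℂ F] {n : ℕ}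
    (y : Fin n → E →L[ℂ] F) (ξ : E) (i : Fin n) :
    colOp y ξ i = y i ξ := rfl

lemma matOp_apply {E F : Type*} [NormedAddCommGroup E] [InnerProductSpace ℂ E]
    [NormedAddCommGroup F] [InnerProductSpace ℂ F] {n : ℕ}
    (t : Fin n → Fin n → E →L[ℂ] F) (ξ : PiLp 2 (fun _ : Fin n => E)) (i : Fin n) :
    matOp t ξ i = ∑ j, t i j (ξ j) := by
  simp [matOp]

lemma adjoint_colOp_comp_colOp {n : ℕ} (y s : Fin n → H →L[ℂ] K) :
    adjoint (colOp y) ∘L colOp s = ∑ i, adjoint (y i) ∘L s i := by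
  ext ξ
  refine ext_inner_left ℂ fun η ↦ ?_
  simp [adjoint_inner_right, PiLp.inner_apply, colOp_apply, sum_apply, inner_sum]

lemma adjoint_matOp {n : ℕ} (t : Fin n → Fin n → H →L[ℂ] K) :
    adjoint (matOp t) = matOp fun i j ↦ adjoint (t j i) := by
  symm
  rw [eq_adjoint_iff]
  intro x y
  simp only [PiLp.inner_apply, matOp_apply, sum_inner, inner_sum, adjoint_inner_left]
  exact Finset.sum_comm

lemma matOp_comp_colOp {E F G : Type*} [NormedAddCommGroup E] [InnerProductSpace ℂ E]
    [NormedAddCommGroup F] [InnerProductSpace ℂ F]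
    [NormedAddCommGroup G] [InnerProductSpace ℂ G] {n : ℕ}
    (t : Fin n → Fin n → E →L[ℂ] F) (d : Fin n → G →L[ℂ] E) :
    matOp t ∘L colOp d = colOp fun i ↦ ∑ j, t i j ∘L d j := by
  ext ξ i
  simp [matOp_apply, colOp_apply, sum_apply]

lemma IsTRO.sum_mem {T : Set (H →L[ℂ] K)} (hT : IsTRO T) {ι : Type*} (s : Finset ι)
    {f : ι → H →L[ℂ] K} (hf : ∀ i ∈ s, f i ∈ T) : ∑ i ∈ s, f i ∈ T := by
  obtain ⟨-, ⟨S, rfl⟩, -⟩ := hT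
  exact S.sum_mem hf

lemma IsTRO.zero_mem {T : Set (H →L[ℂ] K)} (hT : IsTRO T) : (0 : H →L[ℂ] K) ∈ T := by
  obtain ⟨-, ⟨S, rfl⟩, -⟩ := hT
  exact S.zero_mem

lemma IsSubTRO.isTRO {T X : Set (H →L[ℂ] K)} (hX : IsSubTRO T X) : IsTRO X := hX.2

lemma IsTROCondExp.map_zero {T X : Set (H →L[ℂ] K)} {P : (H →L[ℂ] K) → (H →L[ℂ] K)}
    (hP : IsTROCondExp T X P) (hT : IsTRO T) : P 0 = 0 := by
  simpa using hP.2.1 0 0 hT.zero_mem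

lemma IsTROCondExp.map_sum {T X : Set (H →L[ℂ] K)} {P : (H →L[ℂ] K) → (H →L[ℂ] K)}
    (hP : IsTROCondExp T X P) (hT : IsTRO T) {ι : Type*} (s : Finset ι)
    {f : ι → H →L[ℂ] K} (hf : ∀ i ∈ s, f i ∈ T) : P (∑ i ∈ s, f i) = ∑ i ∈ s, P (f i) := by
  classical
  induction s using Finset.induction_on with
  | empty => simpa using hP.map_zero hT
  | insert a s ha ih =>
    have hs : ∀ i ∈ s, f i ∈ T := fun i hi ↦ hf i (Finset.mem_insert_of_mem hi)
    rw [Finset.sum_insert ha, Finset.sum_insert ha,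
      hP.1 _ (hf a (Finset.mem_insert_self a s)) _ (hT.sum_mem s hs), ih hs]

/-- A contractive TRO conditional expectation is contractive on columns. -/
lemma IsTROCondExp.norm_colOp_le {T X : Set (H →L[ℂ] K)} {P : (H →L[ℂ] K) → (H →L[ℂ] K)}
    (hT : IsTRO T) (hX : IsSubTRO T X) (hP : IsTROCondExp T X P) (hPc : ContractiveOn T P)
    {n : ℕ} (s : Fin n → H →L[ℂ] K) (hs : ∀ i, s i ∈ T) :
    ‖colOp fun i ↦ P (s i)‖ ≤ ‖colOp s‖ := by
  have hmem : ∀ i, P (s i) ∈ X := fun i ↦ hP.2.2.1 _ (hs i)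
  set y : Fin n → H →L[ℂ] K := fun i ↦ P (s i) with hy
  have hAA : adjoint (colOp y) ∘L colOp y = ∑ i, adjoint (y i) ∘L y i :=
    adjoint_colOp_comp_colOp y y
  have hz : ∀ z : H →L[ℂ] K, z ∘L (adjoint (colOp y) ∘L colOp y) = ∑ i, tp z (y i) (y i) := by
    intro z
    rw [hAA, comp_finsetSum]
    rfl
  have hadj : ∀ d : K →L[ℂ] H, adjoint ((adjoint (colOp y) ∘L colOp y) ∘L d) =
      adjoint d ∘L (adjoint (colOp y) ∘L colOp y) := by
    intro d
    simp only [adjoint_comp, adjoint_adjoint]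
  refine opNorm_le_of_stable_set (colOp y) (opNorm_nonneg _) {d | adjoint d ∈ X} ?_ ?_
    (fun i ↦ adjoint (y i)) (by simpa using hmem) y hAA
  · intro d hd
    simp only [Set.mem_ofPred_eq] at hd ⊢
    rw [hadj, hz]
    exact hX.isTRO.sum_mem _ fun i _ ↦ hX.2.2.2 _ hd _ (hmem i) _ (hmem i)
  · intro d hd
    simp only [Set.mem_ofPred_eq] at hd
    have hexp : adjoint d ∘L (adjoint (colOp y) ∘L colOp y) =
        P (adjoint d ∘L (adjoint (colOp y) ∘L colOp s)) := by
      rw [hz, adjoint_colOp_comp_colOp, comp_finsetSum, hP.map_sum hT]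
      · exact Finset.sum_congr rfl fun i _ ↦ (hP.2.2.2.2.2.2 _ (hs i) _ hd _ (hmem i)).symm
      · exact fun i _ ↦ hT.2.2 _ (hX.1 hd) _ (hX.1 (hmem i)) _ (hs i)
    have hT' : adjoint d ∘L (adjoint (colOp y) ∘L colOp s) ∈ T := by
      rw [adjoint_colOp_comp_colOp, comp_finsetSum]
      exact hT.sum_mem _ fun i _ ↦ hT.2.2 _ (hX.1 hd) _ (hX.1 (hmem i)) _ (hs i)
    have hgram : ‖(adjoint (colOp y) ∘L colOp y) ∘L d‖ ≤ ‖colOp y ∘L d‖ * ‖colOp s‖ := by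
      rw [← LinearIsometryEquiv.norm_map adjoint ((adjoint (colOp y) ∘L colOp y) ∘L d), hadj,
        hexp]
      refine (hPc _ hT').trans ?_
      rw [← comp_assoc, ← adjoint_comp]
      refine (opNorm_comp_le _ _).trans_eq ?_
      rw [LinearIsometryEquiv.norm_map]
    have hsq : ‖colOp y ∘L d‖ * ‖colOp y ∘L d‖ ≤
        ‖colOp s‖ * ‖d‖ * ‖colOp y ∘L d‖ := by
      rw [← norm_adjoint_comp_self (colOp y ∘L d), adjoint_comp, comp_assoc,
        ← comp_assoc (adjoint (colOp y))]
      calc ‖adjoint d ∘L ((adjoint (colOp y) ∘L colOp y) ∘L d)‖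
          ≤ ‖adjoint d‖ * ‖(adjoint (colOp y) ∘L colOp y) ∘L d‖ := opNorm_comp_le _ _
        _ ≤ ‖d‖ * (‖colOp y ∘L d‖ * ‖colOp s‖) := by
          rw [LinearIsometryEquiv.norm_map]
          gcongr
        _ = ‖colOp s‖ * ‖d‖ * ‖colOp y ∘L d‖ := by ring
    rcases (norm_nonneg (colOp y ∘L d)).eq_or_lt with h | h
    · rw [← h]; positivity
    · exact le_of_mul_le_mul_right hsq h

/-- Operators `d` on `H` acting on `T` from the right and commuting with `P`. -/
def IsRightMultiplier (T : Set (H →L[ℂ] K)) (P : (H →L[ℂ] K) → (H →L[ℂ] K))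
    (d : H →L[ℂ] H) : Prop :=
  ∀ a ∈ T, a ∘L d ∈ T ∧ P (a ∘L d) = P a ∘L d

lemma IsRightMultiplier.sum {T X : Set (H →L[ℂ] K)} {P : (H →L[ℂ] K) → (H →L[ℂ] K)}
    (hT : IsTRO T) (hP : IsTROCondExp T X P) {ι : Type*} (s : Finset ι) {d : ι → H →L[ℂ] H}
    (hd : ∀ i ∈ s, IsRightMultiplier T P (d i)) : IsRightMultiplier T P (∑ i ∈ s, d i) := by
  intro a ha
  rw [comp_finsetSum, comp_finsetSum, hP.map_sum hT s fun i hi ↦ (hd i hi a ha).1]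
  exact ⟨hT.sum_mem s fun i hi ↦ (hd i hi a ha).1,
    Finset.sum_congr rfl fun i hi ↦ (hd i hi a ha).2⟩

lemma IsRightMultiplier.comp {T X : Set (H →L[ℂ] K)} {P : (H →L[ℂ] K) → (H →L[ℂ] K)}
    (hT : IsTRO T) (hX : IsSubTRO T X) (hP : IsTROCondExp T X P) {x y : H →L[ℂ] K}
    (hx : x ∈ X) (hy : y ∈ X) {d : H →L[ℂ] H} (hd : IsRightMultiplier T P d) :
    IsRightMultiplier T P (adjoint x ∘L (y ∘L d)) := by
  intro a ha
  have h := hd _ (hT.2.2 a ha x (hX.1 hx) y (hX.1 hy))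
  rw [hP.2.2.2.2.1 a ha x hx y hy] at h
  exact h

/-- A contractive TRO conditional expectation onto a nondegenerate
sub-TRO is completely contractive. -/
theorem completely_contractive
    (T X : Set (H →L[ℂ] K)) (P : (H →L[ℂ] K) → (H →L[ℂ] K))
    (hT : IsTRO T) (hX : IsSubTRO T X) (hXnd : Nondegenerate T X)
    (hP : IsTROCondExp T X P) (hPc : ContractiveOn T P)
    (n : ℕ) (t : Fin n → Fin n → (H →L[ℂ] K)) (ht : ∀ i j, t i j ∈ T) :
    ‖matOp (fun i j => P (t i j))‖ ≤ ‖matOp t‖ := by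
  have hmem : ∀ i j, P (t i j) ∈ X := fun i j ↦ hP.2.2.1 _ (ht i j)
  set x : Fin n → Fin n → (H →L[ℂ] K) := fun i j ↦ P (t i j) with hx
  have hstable : ∀ d : Fin n → H →L[ℂ] H, (∀ j, IsRightMultiplier T P (d j)) →
      ∃ d' : Fin n → H →L[ℂ] H, (∀ j, IsRightMultiplier T P (d' j)) ∧
        (adjoint (matOp x) ∘L matOp x) ∘L colOp d = colOp d' := by
    intro d hd
    refine ⟨fun i ↦ ∑ k, ∑ j, adjoint (x k i) ∘L (x k j ∘L d j), fun i ↦ ?_, ?_⟩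
    · exact .sum hT hP _ fun k _ ↦ .sum hT hP _ fun j _ ↦
        .comp hT hX hP (hmem k i) (hmem k j) (hd j)
    · rw [comp_assoc, matOp_comp_colOp, adjoint_matOp, matOp_comp_colOp]
      simp only [comp_finsetSum]
  let unit : Fin n → Fin n → H →L[ℂ] H := fun j i ↦ if i = j then .id ℂ H else 0
  have hunit : ∀ j i, IsRightMultiplier T P (unit j i) := by
    intro j i a ha
    by_cases h : i = j
    · simpa [unit, h] using ha
    · simpa [unit, h] using ⟨hT.zero_mem, hP.map_zero hT⟩
  have hdecomp : ∑ j, colOp (unit j) ∘L PiLp.proj 2 (fun _ : Fin n => H) j =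
      .id ℂ (PiLp 2 fun _ : Fin n => H) := by
    ext ξ i
    simp [unit, sum_apply, colOp_apply, apply_ite, ite_apply]
  refine opNorm_le_of_stable_set (matOp x) (opNorm_nonneg _)
    {D | ∃ d : Fin n → H →L[ℂ] H, (∀ j, IsRightMultiplier T P (d j)) ∧ D = colOp d} ?_ ?_
    (fun j ↦ (adjoint (matOp x) ∘L matOp x) ∘L colOp (unit j))
    (fun j ↦ hstable (unit j) (hunit j)) (fun j ↦ PiLp.proj 2 (fun _ : Fin n => H) j) ?_
  · rintro _ ⟨d, hd, rfl⟩
    exact hstable d hd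
  · rintro _ ⟨d, hd, rfl⟩
    have hPcol : matOp x ∘L colOp d = colOp fun i ↦ P (∑ j, t i j ∘L d j) := by
      rw [matOp_comp_colOp]
      congr 1
      ext1 i
      rw [hP.map_sum hT _ fun j _ ↦ (hd j _ (ht i j)).1]
      exact Finset.sum_congr rfl fun j _ ↦ ((hd j _ (ht i j)).2).symm
    rw [hPcol]
    refine (hP.norm_colOp_le hT hX hPc _ fun i ↦
      hT.sum_mem _ fun j _ ↦ (hd j _ (ht i j)).1).trans ?_
    rw [← matOp_comp_colOp]
    exact opNorm_comp_le _ _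
  · simp only [comp_assoc _ (colOp _)]
    rw [← comp_finsetSum, hdecomp, comp_id]
end
end
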